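/- Let G be a hyperbolic group and let d and d' be any two visual metrics on G (with respect to possibly different finite generating sets, basepoints, and parameters). Then d and d' are Hölder equivalent: the identity map (G,d) → (G,d') satisfies a Hölder condition, and so does the identity map (G,d') → (G,d). -/

import Mathlib

open scoped Classical

section Defs

variable {G : Type*}

/-- Word length of `g` with respect to a generating set `A`: the least `n` such that
`g` is a product of `n` elements of `A ∪ A⁻¹`. -/
noncomputable def wordLength [Group G] (A : Set G) (g : G) : ℕ :=
  sInf {n : ℕ | ∃ w : List G, w.length = n ∧ (∀ x ∈ w, x ∈ A ∨ x⁻¹ ∈ A) ∧ w.prod = g}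

/-- The word metric `d_A(g,h)` (as a real number). -/
noncomputable def wordDist [Group G] (A : Set G) (g h : G) : ℝ :=
  (wordLength A (g⁻¹ * h) : ℝ)

/-- The Gromov product `(x|y)_p` with respect to a distance function `d`. -/
noncomputable def gromov {X : Type*} (d : X → X → ℝ) (p x y : X) : ℝ :=
  (d p x + d p y - d x y) / 2

/-- `G` is `δ`-hyperbolic with respect to the generating set `A`. -/
def IsHyperbolicWith [Group G] (A : Set G) (δ : ℝ) : Prop :=
  ∀ p g₀ g₁ g₂ : G,
    min (gromov (wordDist A) p g₀ g₁) (gromov (wordDist A) p g₁ g₂) - δ ≤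
      gromov (wordDist A) p g₀ g₂

/-- `G` is hyperbolic with respect to the generating set `A`. -/
def IsHyperbolic [Group G] (A : Set G) : Prop :=
  ∃ δ : ℝ, 0 ≤ δ ∧ IsHyperbolicWith A δ

/-- `ρ_{p,γ}(g,h) = e^{-γ (g|h)_p}` (and `0` on the diagonal), with respect to a
distance function `dA`. -/
noncomputable def visualRhoOf {X : Type*} (dA : X → X → ℝ) (p : X) (γ : ℝ) (g h : X) : ℝ :=
  if g = h then 0 else Real.exp (-γ * gromov dA p g h)

/-- `d` is a metric on `X`. -/
structure IsMetric {X : Type*} (d : X → X → ℝ) : Prop where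
  refl : ∀ x, d x x = 0
  eq_of : ∀ x y, d x y = 0 → x = y
  symm : ∀ x y, d x y = d y x
  triangle : ∀ x y z, d x z ≤ d x y + d y z

/-- `d` is a visual metric in `V(p,γ,T)` with respect to the distance function `dA`. -/
def InVisualOf {X : Type*} (dA : X → X → ℝ) (p : X) (γ T : ℝ) (d : X → X → ℝ) : Prop :=
  IsMetric d ∧ ∀ g h : X, g ≠ h →
    visualRhoOf dA p γ g h / T ≤ d g h ∧ d g h ≤ T * visualRhoOf dA p γ g h

/-- `d ∈ V^A(p,γ,T)`: `d` is a visual metric with respect to the word metric `d_A`. -/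
def InVisual [Group G] (A : Set G) (p : G) (γ T : ℝ) (d : G → G → ℝ) : Prop :=
  InVisualOf (wordDist A) p γ T d

/-- `φ : (X,d) → (X,d')` satisfies a Hölder condition of exponent `r`. -/
def HolderCondWith {X : Type*} (d d' : X → X → ℝ) (φ : X → X) (r : ℝ) : Prop :=
  ∃ K : ℝ, 0 < K ∧ ∀ g h : X, d' (φ g) (φ h) ≤ K * d g h ^ r

/-- `φ : (X,d) → (X,d')` satisfies a Hölder condition (of some positive exponent). -/
def SatisfiesHolder {X : Type*} (d d' : X → X → ℝ) (φ : X → X) : Prop :=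
  ∃ r : ℝ, 0 < r ∧ HolderCondWith d d' φ r

/-- `φ : (X,d) → (X,d')` satisfies a Lipschitz condition. -/
def LipschitzCond {X : Type*} (d d' : X → X → ℝ) (φ : X → X) : Prop :=
  ∃ K : ℝ, 0 < K ∧ ∀ g h : X, d' (φ g) (φ h) ≤ K * d g h

/-- `φ : (X,d) → (X,d')` is uniformly continuous. -/
def UnifCont {X : Type*} (d d' : X → X → ℝ) (φ : X → X) : Prop :=
  ∀ ε : ℝ, 0 < ε → ∃ δ : ℝ, 0 < δ ∧ ∀ g h : X, d g h < δ → d' (φ g) (φ h) < ε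

/-- `φ : (X,d) → (X,d')` is a quasi-isometric embedding. -/
def QIEmbedding {X : Type*} (d d' : X → X → ℝ) (φ : X → X) : Prop :=
  ∃ lam K : ℝ, 1 ≤ lam ∧ 0 ≤ K ∧ ∀ g h : X,
    (1 / lam) * d g h - K ≤ d' (φ g) (φ h) ∧ d' (φ g) (φ h) ≤ lam * d g h + K

/-- `H` is a quasiconvex subset of `G` with respect to the generating set `A`:
every geodesic word-metric chain joining two points of `H` stays at bounded
distance from `H`. -/
def IsQuasiconvex [Group G] (A : Set G) (H : Set G) : Prop :=
  ∃ q : ℝ, 0 ≤ q ∧ ∀ h ∈ H, ∀ h' ∈ H, ∀ n : ℕ, ∀ g : ℕ → G,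
    g 0 = h → g n = h' → (n : ℝ) = wordDist A h h' →
    (∀ i < n, wordDist A (g i) (g (i + 1)) = 1) →
    ∀ i ≤ n, ∃ z ∈ H, wordDist A (g i) z ≤ q

end Defs

section GeodesicDistance

/-- An integer-valued pseudometric in which any two points are joined by a discrete geodesic. -/
structure IsGeodesicDist {X : Type*} (d : X → X → ℕ) : Prop where
  refl : ∀ x, d x x = 0
  symm : ∀ x y, d x y = d y x
  triangle : ∀ x y z, d x z ≤ d x y + d y z
  exists_path : ∀ x y, ∃ f : ℕ → X, f 0 = x ∧ f (d x y) = y ∧ ∀ i, d (f i) (f (i + 1)) ≤ 1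

/-- The four-point hyperbolicity condition for an integer-valued distance function. -/
def IsDeltaHyperbolic {X : Type*} (d : X → X → ℕ) (δ : ℝ) : Prop :=
  ∀ p x y z : X,
    min (gromov (fun a b => (d a b : ℝ)) p x y) (gromov (fun a b => (d a b : ℝ)) p y z) - δ ≤
      gromov (fun a b => (d a b : ℝ)) p x z

variable {X : Type*} {d e : X → X → ℕ}

namespace IsGeodesicDist

theorem triangle_real (hd : IsGeodesicDist d) (x y z : X) :
    (d x z : ℝ) ≤ d x y + d y z := by
  exact_mod_cast hd.triangle x y z

theorem symm_real (hd : IsGeodesicDist d) (x y : X) : (d x y : ℝ) = d y x := by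
  rw [hd.symm]

theorem path_dist_le (hd : IsGeodesicDist d) {f : ℕ → X}
    (hf : ∀ i, d (f i) (f (i + 1)) ≤ 1) (i k : ℕ) : d (f i) (f (i + k)) ≤ k := by
  induction k with
  | zero => simp [hd.refl]
  | succ k ih =>
    have h₁ := hd.triangle (f i) (f (i + k)) (f (i + (k + 1)))
    have h₂ := hf (i + k)
    rw [add_assoc] at h₂
    omega

theorem path_dist_eq (hd : IsGeodesicDist d) {f : ℕ → X} {n : ℕ}
    (hf : ∀ i, d (f i) (f (i + 1)) ≤ 1) (hn : d (f 0) (f n) = n) {i j : ℕ}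
    (hij : i ≤ j) (hj : j ≤ n) : d (f i) (f j) = j - i := by
  have h₁ := hd.path_dist_le hf 0 i
  have h₂ := hd.path_dist_le hf i (j - i)
  have h₃ := hd.path_dist_le hf j (n - j)
  have h₄ := hd.triangle (f 0) (f i) (f n)
  have h₅ := hd.triangle (f i) (f j) (f n)
  rw [zero_add] at h₁
  rw [Nat.add_sub_cancel' hij] at h₂
  rw [Nat.add_sub_cancel' hj] at h₃
  omega

theorem exists_between (hd : IsGeodesicDist d) (x y : X) {k : ℕ} (hk : k ≤ d x y) :
    ∃ q, d x q = k ∧ d x q + d q y = d x y := by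
  obtain ⟨f, h₀, h₁, hf⟩ := hd.exists_path x y
  have hn : d (f 0) (f (d x y)) = d x y := by rw [h₀, h₁]
  have ha := hd.path_dist_eq hf hn (Nat.zero_le k) hk
  have hb := hd.path_dist_eq hf hn hk le_rfl
  rw [h₀] at ha
  rw [h₁] at hb
  exact ⟨f k, by omega, by omega⟩

end IsGeodesicDist

theorem IsDeltaHyperbolic.sub_le_gromov {δ t : ℝ} (hδ : IsDeltaHyperbolic d δ) {p x y z : X}
    (hxy : t ≤ gromov (fun a b => (d a b : ℝ)) p x y)
    (hyz : t ≤ gromov (fun a b => (d a b : ℝ)) p y z) :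
    t - δ ≤ gromov (fun a b => (d a b : ℝ)) p x z :=
  (sub_le_sub_right (le_min hxy hyz) δ).trans (hδ p x y z)

theorem IsDeltaHyperbolic.gromov_path_ge {δ : ℝ} {L D : ℕ} (hd : IsGeodesicDist d)
    (hδ : IsDeltaHyperbolic d δ) {f : ℕ → X} {p : X}
    (hL : ∀ i, d (f i) (f (i + 1)) ≤ L) (J a b : ℕ) (hab : a ≤ b) (hJ : b ≤ a + 2 ^ J)
    (hD : ∀ i, a ≤ i → i ≤ b → D ≤ d p (f i)) :
    (D : ℝ) - L / 2 - J * δ ≤ gromov (fun u v => (d u v : ℝ)) p (f a) (f b) := by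
  induction J generalizing a b with
  | zero =>
    have h₁ : (D : ℝ) ≤ d p (f a) := by exact_mod_cast hD a le_rfl hab
    have h₂ : (D : ℝ) ≤ d p (f b) := by exact_mod_cast hD b hab le_rfl
    have h₃ : (d (f a) (f b) : ℝ) ≤ L := by
      have : b = a ∨ b = a + 1 := by simp at hJ; omega
      rcases this with rfl | rfl
      · simp [hd.refl]
      · exact_mod_cast hL a
    simp only [gromov, Nat.cast_zero]
    linarith
  | succ J ih =>
    have hp : 2 ^ (J + 1) = 2 ^ J + 2 ^ J := by ring
    have h₁ := ih a (min b (a + 2 ^ J)) (by omega) (by omega)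
      (fun i hi hi' => hD i hi (by omega))
    have h₂ := ih (min b (a + 2 ^ J)) b (by omega) (by omega)
      (fun i hi hi' => hD i (by omega) hi')
    have h₃ := hδ.sub_le_gromov h₁ h₂
    push_cast
    linarith

theorem sq_add_le_four_mul_two_pow (l : ℕ) : l ^ 2 + 2 * l + 3 ≤ 4 * 2 ^ l := by
  induction l with
  | zero => norm_num
  | succ l ih => rw [pow_succ 2 l]; nlinarith

theorem le_of_le_add_mul_log {B δ : ℝ} {D : ℕ} (hD₀ : D ≠ 0)
    (h : (D : ℝ) ≤ B + δ * Nat.log 2 D) : (D : ℝ) ≤ 2 * (B + 2 * δ ^ 2) := by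
  have h₁ : (2 : ℝ) ^ Nat.log 2 D ≤ D := by exact_mod_cast Nat.pow_log_le_self 2 hD₀
  have h₂ : ((Nat.log 2 D : ℕ) : ℝ) ^ 2 + 2 * (Nat.log 2 D : ℕ) + 3 ≤ 4 * 2 ^ Nat.log 2 D := by
    exact_mod_cast sq_add_le_four_mul_two_pow (Nat.log 2 D)
  have h₃ : (0 : ℝ) ≤ Nat.log 2 D := Nat.cast_nonneg _
  nlinarith [sq_nonneg ((Nat.log 2 D : ℝ) - 4 * δ)]

/-- A point of the path far from `q` in the direction of the endpoint `x`. -/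
theorem IsGeodesicDist.exists_detour (hd : IsGeodesicDist d) {f : ℕ → X} {n D : ℕ} {q x y : X}
    (hq : d x q + d q y = d x y) (hx : ∃ i ≤ n, f i = x)
    (hnear : ∀ q, d x q + d q y = d x y → ∃ i ≤ n, d q (f i) ≤ D)
    (hfar : ∀ i ≤ n, D ≤ d q (f i)) :
    ∃ a, ∃ i ≤ n, d x a + d a q = d x q ∧ d q (f i) ≤ 3 * D ∧
      (D : ℝ) ≤ gromov (fun u v => (d u v : ℝ)) q a (f i) := by
  rcases le_total (d q x) (2 * D) with h | h
  · obtain ⟨i, hi, hix⟩ := hx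
    have hDx := hfar i hi
    refine ⟨x, i, hi, by simp [hd.refl], by rw [hix]; omega, ?_⟩
    rw [hix] at hDx ⊢
    have : (D : ℝ) ≤ d q x := by exact_mod_cast hDx
    simp only [gromov, hd.refl]
    push_cast
    linarith
  · obtain ⟨a, ha, ha'⟩ := hd.exists_between q x h
    have s₁ := hd.symm a x
    have s₂ := hd.symm a q
    have s₃ := hd.symm q x
    have t₁ := hd.triangle x a y
    have t₂ := hd.triangle a q y
    obtain ⟨i, hi, hai⟩ := hnear a (by omega)
    have t₃ := hd.triangle q a (f i)
    refine ⟨a, i, hi, by omega, by omega, ?_⟩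
    have h₁ : (D : ℝ) ≤ d q (f i) := by exact_mod_cast hfar i hi
    have h₂ : (d a (f i) : ℝ) ≤ D := by exact_mod_cast hai
    have h₃ : (d q a : ℝ) = 2 * D := by exact_mod_cast ha
    simp only [gromov]
    linarith

/-- Geodesics for a hyperbolic distance stay uniformly close to the geodesics of any
bi-Lipschitz equivalent distance with the same endpoints. -/
theorem IsDeltaHyperbolic.exists_near_path {δ : ℝ} {L : ℕ} (hd : IsGeodesicDist d)
    (he : IsGeodesicDist e) (hδ : IsDeltaHyperbolic d δ) (hδ₀ : 0 ≤ δ)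
    (hde : ∀ x y, d x y ≤ L * e x y) (hed : ∀ x y, e x y ≤ L * d x y) :
    ∃ H : ℝ, ∀ (f : ℕ → X) (n : ℕ), (∀ i, e (f i) (f (i + 1)) ≤ 1) → e (f 0) (f n) = n →
      ∀ q, d (f 0) q + d q (f n) = d (f 0) (f n) → ∃ i ≤ n, (d q (f i) : ℝ) ≤ H := by
  refine ⟨2 * ((L / 2 + δ * (6 * L + 3)) + 2 * δ ^ 2), ?_⟩
  intro f n hf hn
  have hex : ∃ D : ℕ, ∀ q, d (f 0) q + d q (f n) = d (f 0) (f n) → ∃ i ≤ n, d q (f i) ≤ D :=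
    ⟨d (f 0) (f n), fun q hq => ⟨0, Nat.zero_le _, by have := hd.symm q (f 0); omega⟩⟩
  obtain ⟨D, hD, hmin⟩ : ∃ D : ℕ,
      (∀ q, d (f 0) q + d q (f n) = d (f 0) (f n) → ∃ i ≤ n, d q (f i) ≤ D) ∧
      ∀ m < D, ¬ ∀ q, d (f 0) q + d q (f n) = d (f 0) (f n) → ∃ i ≤ n, d q (f i) ≤ m :=
    ⟨Nat.find hex, Nat.find_spec hex, fun m hm => Nat.find_min hex hm⟩
  suffices hDH : (D : ℝ) ≤ 2 * ((L / 2 + δ * (6 * L + 3)) + 2 * δ ^ 2) by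
    intro q hq
    obtain ⟨i, hi, hqi⟩ := hD q hq
    exact ⟨i, hi, le_trans (by exact_mod_cast hqi) hDH⟩
  rcases Nat.eq_zero_or_pos D with rfl | hpos
  · push_cast; positivity
  have hfail := hmin (D - 1) (by omega)
  push Not at hfail
  obtain ⟨q, hq, hqfar⟩ := hfail
  have hfar : ∀ i ≤ n, D ≤ d q (f i) := fun i hi => by have := hqfar i hi; omega
  obtain ⟨a, i, hi, ha, hqi, hai⟩ :=
    hd.exists_detour hq ⟨0, Nat.zero_le _, rfl⟩ hD hfar
  have hswap : ∀ q, d (f n) q + d q (f 0) = d (f n) (f 0) ↔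
      d (f 0) q + d q (f n) = d (f 0) (f n) := fun q => by
    rw [hd.symm (f n) q, hd.symm q (f 0), hd.symm (f n) (f 0), add_comm]
  obtain ⟨b, j, hj, hb, hqj, hbj⟩ :=
    hd.exists_detour ((hswap q).2 hq) ⟨n, le_rfl, rfl⟩ (fun q h => hD q ((hswap q).1 h)) hfar
  have hL : ∀ i, d (f i) (f (i + 1)) ≤ L := fun i =>
    (hde _ _).trans (by simpa using Nat.mul_le_mul_left L (hf i))
  have hij : e (f i) (f j) ≤ L * (6 * D) := (hed _ _).trans <| Nat.mul_le_mul_left L <| by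
    have h₁ := hd.triangle (f i) q (f j)
    have h₂ := hd.symm (f i) q
    omega
  have hJ : L * (6 * D) ≤ 2 ^ (6 * L + (Nat.log 2 D + 1)) := by
    have h₁ : 6 * L ≤ 2 ^ (6 * L) := Nat.lt_two_pow_self.le
    have h₂ : D ≤ 2 ^ (Nat.log 2 D + 1) := (Nat.lt_pow_succ_log_self (by norm_num) D).le
    calc L * (6 * D) = (6 * L) * D := by ring
      _ ≤ _ := by rw [pow_add]; exact Nat.mul_le_mul h₁ h₂
  have hmid : (D : ℝ) - L / 2 - (6 * L + (Nat.log 2 D + 1) : ℕ) * δ ≤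
      gromov (fun u v => (d u v : ℝ)) q (f i) (f j) := by
    rcases le_total i j with h | h
    · have := he.path_dist_eq hf hn h hj
      exact hδ.gromov_path_ge hd hL _ i j h (by omega) (fun k _ hk => hfar k (hk.trans hj))
    · have := he.path_dist_eq hf hn h hi
      have s := he.symm (f i) (f j)
      have h₁ := hδ.gromov_path_ge hd hL (6 * L + (Nat.log 2 D + 1)) j i h (by omega)
        (fun k _ hk => hfar k (hk.trans hi))
      simp only [gromov] at h₁ ⊢
      rw [hd.symm_real (f i) (f j)]
      linarith
  have hzero : gromov (fun u v => (d u v : ℝ)) q a b = 0 := by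
    have h₁ := hd.triangle (f 0) a (f n)
    have h₂ := hd.triangle a b (f n)
    have h₃ := hd.triangle a q b
    have s₁ := hd.symm b (f n)
    have s₂ := hd.symm q (f n)
    have s₃ := hd.symm b q
    have s₄ := hd.symm a q
    have : d q a + d q b = d a b := by omega
    have : (d q a : ℝ) + d q b = d a b := by exact_mod_cast this
    simp only [gromov]
    linarith
  have hjb : gromov (fun u v => (d u v : ℝ)) q (f j) b =
      gromov (fun u v => (d u v : ℝ)) q b (f j) := by
    simp only [gromov]
    rw [hd.symm_real b (f j)]
    ring
  refine le_of_le_add_mul_log hpos.ne' ?_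
  push_cast at hmid
  have h₁ : (0 : ℝ) ≤ L := Nat.cast_nonneg _
  have h₂ : 0 ≤ (6 * L + (Nat.log 2 D + 1)) * δ := by positivity
  have h₃ := hδ.sub_le_gromov hmid (by rw [hjb]; linarith)
  have h₄ := hδ.sub_le_gromov (le_trans (by linarith) hai) h₃
  rw [hzero] at h₄
  linarith

theorem IsDeltaHyperbolic.exists_near_between {δ : ℝ} {L : ℕ} (hd : IsGeodesicDist d)
    (he : IsGeodesicDist e) (hδ : IsDeltaHyperbolic d δ) (hδ₀ : 0 ≤ δ)
    (hde : ∀ x y, d x y ≤ L * e x y) (hed : ∀ x y, e x y ≤ L * d x y) :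
    ∃ H : ℝ, ∀ x y q, d x q + d q y = d x y →
      ∃ u, e x u + e u y = e x y ∧ (d q u : ℝ) ≤ H := by
  obtain ⟨H, hH⟩ := hδ.exists_near_path hd he hδ₀ hde hed
  refine ⟨H, fun x y q hq => ?_⟩
  obtain ⟨f, h₀, h₁, hf⟩ := he.exists_path x y
  have hn : e (f 0) (f (e x y)) = e x y := by rw [h₀, h₁]
  obtain ⟨i, hi, hqi⟩ := hH f _ hf hn q (by rwa [h₀, h₁])
  have ha := he.path_dist_eq hf hn (Nat.zero_le i) hi
  have hb := he.path_dist_eq hf hn hi le_rfl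
  rw [h₀] at ha
  rw [h₁] at hb
  exact ⟨f i, by omega, hqi⟩

theorem IsDeltaHyperbolic.exists_gromov_between_le {δ : ℝ} {L : ℕ} (hd : IsGeodesicDist d)
    (he : IsGeodesicDist e) (hδ : IsDeltaHyperbolic d δ) (hδ₀ : 0 ≤ δ)
    (hde : ∀ x y, d x y ≤ L * e x y) (hed : ∀ x y, e x y ≤ L * d x y) :
    ∃ M : ℝ, ∀ x y z, e x z + e z y = e x y →
      gromov (fun u v => (d u v : ℝ)) z x y ≤ M := by
  obtain ⟨H, hH⟩ := hδ.exists_near_between hd he hδ₀ hde hed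
  refine ⟨L * (L * (2 * H + 4 * δ)) + H + 1, fun x y z hz => ?_⟩
  set g := gromov (fun u v => (d u v : ℝ)) z x y with hg
  have hg' : g = ((d z x : ℝ) + d z y - d x y) / 2 := rfl
  have t₁ := hd.triangle_real x z y
  have t₂ := hd.triangle_real z x y
  have t₃ := hd.triangle_real z y x
  have s₁ := hd.symm_real x z
  have s₂ := hd.symm_real x y
  have hg₀ : 0 ≤ g := by linarith
  have hm := Nat.floor_le hg₀
  have hm' := Nat.lt_floor_add_one g
  set m := ⌊g⌋₊
  obtain ⟨q₁, hq₁, hq₁'⟩ := hd.exists_between z x (k := m) (by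
    have : (m : ℝ) ≤ d z x := by linarith
    exact_mod_cast this)
  obtain ⟨q₂, hq₂, hq₂'⟩ := hd.exists_between z y (k := m) (by
    have : (m : ℝ) ≤ d z y := by linarith
    exact_mod_cast this)
  obtain ⟨u, hu, hu'⟩ := hH z x q₁ hq₁'
  obtain ⟨v, hv, hv'⟩ := hH z y q₂ hq₂'
  have c₁ : (d z q₁ : ℝ) = m := by exact_mod_cast hq₁
  have c₂ : (d z q₂ : ℝ) = m := by exact_mod_cast hq₂
  have c₁' : (d z q₁ : ℝ) + d q₁ x = d z x := by exact_mod_cast hq₁'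
  have c₂' : (d z q₂ : ℝ) + d q₂ y = d z y := by exact_mod_cast hq₂'
  have hq : (d q₁ q₂ : ℝ) ≤ 4 * δ := by
    have h₃ : (m : ℝ) ≤ gromov (fun u v => (d u v : ℝ)) z q₁ x := by
      simp only [gromov]; linarith
    have h₄ : (m : ℝ) ≤ gromov (fun u v => (d u v : ℝ)) z y q₂ := by
      simp only [gromov]; rw [hd.symm_real y q₂]; linarith
    have h₇ := hδ.sub_le_gromov (t := m - δ) (by linarith) (hδ.sub_le_gromov hm h₄)
    simp only [gromov] at h₇
    linarith
  have huv : (d u v : ℝ) ≤ 2 * H + 4 * δ := by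
    have h₁ := hd.triangle_real u q₁ v
    have h₂ := hd.triangle_real q₁ q₂ v
    have h₃ := hd.symm_real u q₁
    linarith
  have hzu : e z u ≤ e u v := by
    have h₁ := he.triangle x u y
    have h₂ := he.triangle u v y
    have h₃ := he.symm x z
    have h₄ := he.symm x u
    omega
  have hL : (0 : ℝ) ≤ L := Nat.cast_nonneg _
  have h₁ : (e u v : ℝ) ≤ L * d u v := by exact_mod_cast hed u v
  have h₂ : (d z u : ℝ) ≤ L * e z u := by exact_mod_cast hde z u
  have h₃ : (e z u : ℝ) ≤ e u v := by exact_mod_cast hzu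
  have h₄ : (d z u : ℝ) ≤ L * (L * (2 * H + 4 * δ)) :=
    h₂.trans (mul_le_mul_of_nonneg_left
      ((h₃.trans h₁).trans (mul_le_mul_of_nonneg_left huv hL)) hL)
  have h₅ := hd.triangle_real z u q₁
  have h₆ := hd.symm_real u q₁
  linarith

theorem IsDeltaHyperbolic.exists_between_near {δ : ℝ} (he : IsGeodesicDist e)
    (hδ : IsDeltaHyperbolic e δ) (p x y : X) :
    ∃ z, e x z + e z y = e x y ∧
      (e p z : ℝ) ≤ gromov (fun u v => (e u v : ℝ)) p x y + (2 * δ + 1) := by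
  set g := ((e x y : ℝ) + e x p - e y p) / 2 with hg
  have t₁ := he.triangle_real y x p
  have t₂ := he.triangle_real x y p
  have s₁ := he.symm_real x y
  have s₂ := he.symm_real x p
  have s₃ := he.symm_real y p
  have hm := Nat.floor_le (show 0 ≤ g by linarith)
  have hm' := Nat.lt_floor_add_one g
  set m := ⌊g⌋₊
  obtain ⟨z, hz, hz'⟩ := he.exists_between x y (k := m) (by
    have : (m : ℝ) ≤ e x y := by linarith
    exact_mod_cast this)
  refine ⟨z, hz', ?_⟩
  have c₁ : (e x z : ℝ) = m := by exact_mod_cast hz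
  have c₂ : (e x z : ℝ) + e z y = e x y := by exact_mod_cast hz'
  have h := hδ z x p y
  have s₄ := he.symm_real x z
  have s₅ := he.symm_real p z
  simp only [gromov] at h ⊢
  rcases min_cases (((e z x : ℝ) + e z p - e x p) / 2) (((e z p : ℝ) + e z y - e p y) / 2) with
    ⟨h₁, -⟩ | ⟨h₁, -⟩ <;> rw [h₁] at h <;> linarith

/-- Gromov products of two bi-Lipschitz equivalent hyperbolic geodesic distances are
comparable up to affine functions. -/
theorem exists_gromov_le {δ δ' : ℝ} {L : ℕ} (hd : IsGeodesicDist d)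
    (he : IsGeodesicDist e) (hδ : IsDeltaHyperbolic d δ) (hδ₀ : 0 ≤ δ)
    (hδ' : IsDeltaHyperbolic e δ')
    (hde : ∀ x y, d x y ≤ L * e x y) (hed : ∀ x y, e x y ≤ L * d x y) (p p' : X) :
    ∃ C : ℝ, ∀ x y, gromov (fun u v => (d u v : ℝ)) p x y ≤
      L * gromov (fun u v => (e u v : ℝ)) p' x y + C := by
  obtain ⟨M, hM⟩ := hδ.exists_gromov_between_le hd he hδ₀ hde hed
  refine ⟨L * (2 * δ' + 1) + d p p' + M, fun x y => ?_⟩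
  obtain ⟨z, hz, hpz⟩ := hδ'.exists_between_near he p' x y
  have h₁ := hM x y z hz
  have hL : (0 : ℝ) ≤ L := Nat.cast_nonneg _
  have h₂ : (d p' z : ℝ) ≤ L * e p' z := by exact_mod_cast hde p' z
  have h₃ := mul_le_mul_of_nonneg_left hpz hL
  have h₄ := hd.triangle_real p p' z
  have h₅ := hd.triangle_real p z x
  have h₆ := hd.triangle_real p z y
  have h₇ : gromov (fun u v => (d u v : ℝ)) p x y ≤
      gromov (fun u v => (d u v : ℝ)) z x y + d p z := by
    simp only [gromov]; linarith
  linarith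

end GeodesicDistance

section WordLength

variable {G : Type*} [Group G] {A : Set G}

theorem wordLength_le_length {g : G} {w : List G} (hw : ∀ x ∈ w, x ∈ A ∨ x⁻¹ ∈ A)
    (hg : w.prod = g) : wordLength A g ≤ w.length :=
  Nat.sInf_le ⟨w, rfl, hw, hg⟩

theorem exists_list_wordLength (hA : Subgroup.closure A = ⊤) (g : G) :
    ∃ w : List G, w.length = wordLength A g ∧ (∀ x ∈ w, x ∈ A ∨ x⁻¹ ∈ A) ∧ w.prod = g := by
  refine Nat.sInf_mem (s := {n : ℕ | ∃ w : List G, w.length = n ∧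
    (∀ x ∈ w, x ∈ A ∨ x⁻¹ ∈ A) ∧ w.prod = g}) ?_
  have hg : g ∈ (Subgroup.closure A).toSubmonoid := by rw [hA]; trivial
  rw [Subgroup.closure_toSubmonoid] at hg
  obtain ⟨w, hw, hg⟩ := Submonoid.exists_list_of_mem_closure hg
  exact ⟨w.length, w, rfl, hw, hg⟩

theorem wordLength_one : wordLength A (1 : G) = 0 :=
  Nat.le_zero.1 (wordLength_le_length (w := []) (by simp) (by simp))

theorem wordLength_le_one {a : G} (ha : a ∈ A ∨ a⁻¹ ∈ A) : wordLength A a ≤ 1 :=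
  wordLength_le_length (w := [a]) (by simpa using ha) (by simp)

theorem wordLength_mul_le (hA : Subgroup.closure A = ⊤) (g h : G) :
    wordLength A (g * h) ≤ wordLength A g + wordLength A h := by
  obtain ⟨v, hv, hv', rfl⟩ := exists_list_wordLength hA g
  obtain ⟨w, hw, hw', rfl⟩ := exists_list_wordLength hA h
  rw [← hv, ← hw, ← List.length_append]
  refine wordLength_le_length (fun x hx => ?_) List.prod_append
  exact (List.mem_append.1 hx).elim (hv' x) (hw' x)

theorem wordLength_inv_le (hA : Subgroup.closure A = ⊤) (g : G) :
    wordLength A g⁻¹ ≤ wordLength A g := by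
  obtain ⟨w, hw, hw', rfl⟩ := exists_list_wordLength hA g
  rw [← hw, List.prod_inv_reverse]
  refine (wordLength_le_length (fun x hx => ?_) rfl).trans_eq (by simp)
  simp only [List.mem_reverse, List.mem_map] at hx
  obtain ⟨y, hy, rfl⟩ := hx
  rw [inv_inv]
  exact (hw' y hy).symm

theorem wordLength_inv (hA : Subgroup.closure A = ⊤) (g : G) :
    wordLength A g⁻¹ = wordLength A g :=
  (wordLength_inv_le hA g).antisymm (by simpa using wordLength_inv_le hA g⁻¹)

theorem isGeodesicDist_wordLength (hA : Subgroup.closure A = ⊤) :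
    IsGeodesicDist (fun g h : G => wordLength A (g⁻¹ * h)) where
  refl x := by simp [wordLength_one]
  symm x y := by
    rw [← wordLength_inv hA]
    simp
  triangle x y z := by
    have := wordLength_mul_le hA (x⁻¹ * y) (y⁻¹ * z)
    rwa [show x⁻¹ * y * (y⁻¹ * z) = x⁻¹ * z by group] at this
  exists_path x y := by
    obtain ⟨w, hw, hw', hp⟩ := exists_list_wordLength hA (x⁻¹ * y)
    refine ⟨fun i => x * (w.take i).prod, by simp, ?_, fun i => ?_⟩
    · simp [← hw, hp]
    · dsimp only
      rcases lt_or_ge i w.length with hi | hi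
      · rw [List.prod_take_succ w i hi]
        convert wordLength_le_one (hw' _ (List.getElem_mem hi)) using 2
        group
      · rw [List.take_of_length_le hi, List.take_of_length_le (hi.trans (Nat.le_succ i))]
        simp [wordLength_one]

theorem exists_wordLength_le_mul {A' : Set G} (hfin : A.Finite) (hA : Subgroup.closure A = ⊤)
    (hA' : Subgroup.closure A' = ⊤) :
    ∃ L : ℕ, ∀ g, wordLength A' g ≤ L * wordLength A g := by
  obtain ⟨L, hL⟩ := (hfin.image (wordLength A')).bddAbove
  have hL' : ∀ a, a ∈ A ∨ a⁻¹ ∈ A → wordLength A' a ≤ L := by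
    rintro a (ha | ha)
    · exact hL ⟨a, ha, rfl⟩
    · rw [← wordLength_inv hA']
      exact hL ⟨a⁻¹, ha, rfl⟩
  refine ⟨L, fun g => ?_⟩
  obtain ⟨w, hw, hw', rfl⟩ := exists_list_wordLength hA g
  rw [← hw]
  clear hw
  induction w with
  | nil => simp [wordLength_one]
  | cons a w ih =>
    have h₁ := wordLength_mul_le hA' a w.prod
    have h₂ := hL' a (hw' a (by simp))
    have h₃ := ih (fun x hx => hw' x (by simp [hx]))
    rw [List.prod_cons, List.length_cons, mul_add]
    omega

end WordLength

/-- An affine comparison of Gromov products yields a Hölder condition between visual metrics. -/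
theorem satisfiesHolder_of_gromov_le {X : Type*} {D D' d d' : X → X → ℝ} {p p' : X}
    {γ γ' T T' L C : ℝ} (hγ : 0 < γ) (hγ' : 0 < γ') (hT : 1 ≤ T) (hT' : 1 ≤ T')
    (hL : 0 < L) (hd : InVisualOf D p γ T d) (hd' : InVisualOf D' p' γ' T' d')
    (hC : ∀ x y, gromov D p x y ≤ L * gromov D' p' x y + C) :
    SatisfiesHolder d d' (id : X → X) := by
  have hT₀ : 0 < T := by linarith
  have hT'₀ : 0 < T' := by linarith
  set r := γ' / (γ * L) with hr
  have hr₀ : 0 < r := by positivity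
  refine ⟨r, hr₀, T' * Real.exp (γ' * C / L) * T ^ r, by positivity, fun g h => ?_⟩
  rcases eq_or_ne g h with rfl | hne
  · simp [hd.1.refl, hd'.1.refl, Real.zero_rpow hr₀.ne']
  have h₁ := (hd.2 g h hne).1
  have h₂ := (hd'.2 g h hne).2
  rw [visualRhoOf, if_neg hne] at h₁ h₂
  rw [div_le_iff₀ hT₀] at h₁
  have hd₀ : 0 ≤ d g h := le_of_mul_le_mul_right
    (by simpa using (Real.exp_pos _).le.trans h₁) hT₀
  have h₃ := Real.rpow_le_rpow (Real.exp_pos _).le h₁ hr₀.le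
  rw [← Real.exp_mul, Real.mul_rpow hd₀ hT₀.le] at h₃
  have h₄ : -γ' * gromov D' p' g h ≤ γ' * C / L + -γ * gromov D p g h * r := by
    have h₅ : -γ * gromov D p g h * r = -(γ' / L * gromov D p g h) := by
      rw [hr]; field_simp
    have h₆ := mul_le_mul_of_nonneg_left (hC g h) (show 0 ≤ γ' / L by positivity)
    have h₇ : γ' / L * (L * gromov D' p' g h + C) = γ' * gromov D' p' g h + γ' * C / L := by
      field_simp
    linarith
  calc d' g h ≤ T' * Real.exp (-γ' * gromov D' p' g h) := h₂
    _ ≤ T' * Real.exp (γ' * C / L + -γ * gromov D p g h * r) := by gcongr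
    _ = T' * Real.exp (γ' * C / L) * Real.exp (-γ * gromov D p g h * r) := by
      rw [Real.exp_add]; ring
    _ ≤ T' * Real.exp (γ' * C / L) * (d g h ^ r * T ^ r) := by gcongr
    _ = _ := by ring

/-- Any two visual metrics on a hyperbolic group are Hölder equivalent. -/
theorem stmt_4 {G : Type*} [Group G] (A A' : Set G)
    (hAfin : A.Finite) (hA'fin : A'.Finite)
    (hAgen : Subgroup.closure A = ⊤) (hA'gen : Subgroup.closure A' = ⊤)
    (hhyp : IsHyperbolic A) (hhyp' : IsHyperbolic A')
    (p p' : G) (γ γ' T T' : ℝ) (hγ : 0 < γ) (hγ' : 0 < γ')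
    (hT : 1 ≤ T) (hT' : 1 ≤ T')
    (d d' : G → G → ℝ) (hd : InVisual A p γ T d) (hd' : InVisual A' p' γ' T' d') :
    SatisfiesHolder d d' (id : G → G) ∧ SatisfiesHolder d' d (id : G → G) := by
  obtain ⟨δ, hδ₀, hδ⟩ := hhyp
  obtain ⟨δ', hδ'₀, hδ'⟩ := hhyp'
  obtain ⟨L₁, hL₁⟩ := exists_wordLength_le_mul hA'fin hA'gen hAgen
  obtain ⟨L₂, hL₂⟩ := exists_wordLength_le_mul hAfin hAgen hA'gen
  have hLe₁ : ∀ x y : G, wordLength A (x⁻¹ * y) ≤ (L₁ + L₂ + 1) * wordLength A' (x⁻¹ * y) :=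
    fun x y => (hL₁ _).trans (Nat.mul_le_mul_right _ (by omega))
  have hLe₂ : ∀ x y : G, wordLength A' (x⁻¹ * y) ≤ (L₁ + L₂ + 1) * wordLength A (x⁻¹ * y) :=
    fun x y => (hL₂ _).trans (Nat.mul_le_mul_right _ (by omega))
  have hgeo := isGeodesicDist_wordLength hAgen
  have hgeo' := isGeodesicDist_wordLength hA'gen
  obtain ⟨C, hC⟩ := exists_gromov_le hgeo hgeo' hδ hδ₀ hδ' hLe₁ hLe₂ p p'
  obtain ⟨C', hC'⟩ := exists_gromov_le hgeo' hgeo hδ' hδ'₀ hδ hLe₂ hLe₁ p' p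
  have hpos : (0 : ℝ) < (L₁ + L₂ + 1 : ℕ) := by positivity
  exact ⟨satisfiesHolder_of_gromov_le hγ hγ' hT hT' hpos hd hd' hC,
    satisfiesHolder_of_gromov_le hγ' hγ hT' hT hpos hd' hd hC'⟩
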